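/- (Theorem 3, unconstrained regime.) Let p0, p1 ∈ (0,1) with p0 < 1/2 ≤ p1, γ ∈ [0,1), δ ∈ (0,1), and let b_h' = (2(1−γ)δ+γ)(1−p0−p1) + 2p1 − 1. If b > b_h', then the tuple (a0, a1, d0, d1) with a0 = a1 = 1/2, d0 = D0(1/2, 1/2), d1 = D1(1/2, 1/2) is feasible for problem P2 and attains the maximum of P2: every feasible tuple has objective value at most F(a0, a1, d0, d1). -/

import Mathlib

/-- Binary entropy function (natural log, `Real.log 0 = 0` gives the `0 log 0 = 0` convention). -/
noncomputable def binEnt (a : ℝ) : ℝ := -a * Real.log a - (1 - a) * Real.log (1 - a)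

/-- Feasibility for problem P2. -/
def FeasP2 (p0 p1 γ δ b a0 a1 d0 d1 : ℝ) : Prop :=
  a0 ∈ Set.Icc (0:ℝ) 1 ∧ a1 ∈ Set.Icc (0:ℝ) 1 ∧ 0 ≤ d0 ∧ 0 ≤ d1 ∧
    (1 - γ * a0) * d0 - γ * a1 * d1 = (1 - γ) * δ ∧ d0 + d1 = 1 ∧
    2 * d0 * |a0 - p0| + 2 * d1 * |a1 - p1| ≤ b

/-- Objective of problem P2. -/
noncomputable def objP2 (a0 a1 d0 d1 : ℝ) : ℝ := d0 * binEnt a0 + d1 * binEnt a1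

/-- Discounted visitation frequency of state 0 induced by the deterministic policy `(a0, a1)`. -/
noncomputable def D0 (γ δ a0 a1 : ℝ) : ℝ := ((1 - γ) * δ + γ * a1) / (1 - γ * a0 + γ * a1)

/-- Discounted visitation frequency of state 1. -/
noncomputable def D1 (γ δ a0 a1 : ℝ) : ℝ := 1 - D0 γ δ a0 a1

theorem binEnt_eq_binEntropy (a : ℝ) : binEnt a = Real.binEntropy a := by
  rw [binEnt, Real.binEntropy, Real.log_inv, Real.log_inv]
  ring

theorem binEnt_le_log_two (a : ℝ) : binEnt a ≤ Real.log 2 :=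
  binEnt_eq_binEntropy a ▸ Real.binEntropy_le_log_two

theorem binEnt_half : binEnt (1 / 2) = Real.log 2 := by
  rw [binEnt_eq_binEntropy, one_div, Real.binEntropy_two_inv]

theorem D0_half (γ δ : ℝ) : D0 γ δ (1 / 2) (1 / 2) = (1 - γ) * δ + γ / 2 := by
  rw [D0]
  ring

/-- Theorem 3, unconstrained regime (`p0 < 1/2 ≤ p1`, `b > b_h'`). -/
theorem thm3_unconstrained
    (p0 p1 γ δ b : ℝ)
    (hp0 : p0 ∈ Set.Ioo (0:ℝ) 1) (hp1 : p1 ∈ Set.Ioo (0:ℝ) 1)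
    (hp0half : p0 < 1/2) (hp1half : 1/2 ≤ p1)
    (hγ : γ ∈ Set.Ico (0:ℝ) 1) (hδ : δ ∈ Set.Ioo (0:ℝ) 1)
    (hb : (2 * ((1 - γ) * δ) + γ) * (1 - p0 - p1) + 2 * p1 - 1 < b) :
    FeasP2 p0 p1 γ δ b (1/2) (1/2) (D0 γ δ (1/2) (1/2)) (D1 γ δ (1/2) (1/2)) ∧
      ∀ a0 a1 d0 d1 : ℝ, FeasP2 p0 p1 γ δ b a0 a1 d0 d1 →
        objP2 a0 a1 d0 d1 ≤ objP2 (1/2) (1/2) (D0 γ δ (1/2) (1/2)) (D1 γ δ (1/2) (1/2)) := by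
  obtain ⟨hγ0, hγ1⟩ := hγ
  obtain ⟨hδ0, hδ1⟩ := hδ
  have hγδ0 : 0 ≤ (1 - γ) * δ := mul_nonneg (by linarith) hδ0.le
  have hγδ1 : (1 - γ) * δ ≤ 1 - γ := mul_le_of_le_one_right (by linarith) hδ1.le
  constructor
  · rw [FeasP2, D1, D0_half, abs_of_pos (by linarith), abs_of_nonpos (by linarith)]
    refine ⟨by norm_num, by norm_num, by linarith, by linarith, by ring, by ring, ?_⟩
    linarith
  · rintro a0 a1 d0 d1 ⟨-, -, hd0, hd1, -, hsum, -⟩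
    calc objP2 a0 a1 d0 d1 ≤ d0 * Real.log 2 + d1 * Real.log 2 :=
          add_le_add (mul_le_mul_of_nonneg_left (binEnt_le_log_two a0) hd0)
            (mul_le_mul_of_nonneg_left (binEnt_le_log_two a1) hd1)
      _ = Real.log 2 := by rw [← add_mul, hsum, one_mul]
      _ = objP2 (1/2) (1/2) (D0 γ δ (1/2) (1/2)) (D1 γ δ (1/2) (1/2)) := by
          rw [objP2, D1, binEnt_half]
          ring
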